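/- arXiv:1811.07399 — 9 statements merged into one kernel-verified Lean document; each statement's English description precedes it below -/
import Mathlib

section
/- Let n ≥ 1 be an integer and ζ ∈ ℂ a primitive n-th root of unity. Let σ be the ℂ-algebra automorphism of the polynomial ring ℂ[z₁, z₂] determined by σ(z₁) = ζ·z₁ and σ(z₂) = ζ⁻¹·z₂. Then the subalgebra of σ-invariant polynomials {p ∈ ℂ[z₁, z₂] | σ(p) = p} is exactly the ℂ-subalgebra generated by z₁z₂, z₁ⁿ and z₂ⁿ. -/
open MvPolynomial

theorem mono_eq_aux (m : Fin 2 →₀ ℕ) (c : ℂ) :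
    monomial m c = C c * (X 0 ^ m 0 * X 1 ^ m 1) := by
  rw [monomial_eq, Finsupp.prod_fintype _ _ (by simp), Fin.prod_univ_two]

theorem sigma_mono_aux (ζ : ℂ)
    (σ : MvPolynomial (Fin 2) ℂ ≃ₐ[ℂ] MvPolynomial (Fin 2) ℂ)
    (h1 : σ (X 0) = C ζ * X 0) (h2 : σ (X 1) = C ζ⁻¹ * X 1) (m : Fin 2 →₀ ℕ) (c : ℂ) :
    σ (monomial m c) = monomial m (ζ ^ m 0 * ζ⁻¹ ^ m 1 * c) := by
  have hC : σ (C c) = C c := σ.commutes c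
  rw [mono_eq_aux, mono_eq_aux, map_mul, map_mul, map_pow, map_pow, h1, h2, hC]
  simp only [C_mul, C_pow, mul_pow]
  ring

theorem coeff_sigma_aux (ζ : ℂ)
    (σ : MvPolynomial (Fin 2) ℂ ≃ₐ[ℂ] MvPolynomial (Fin 2) ℂ)
    (h1 : σ (X 0) = C ζ * X 0) (h2 : σ (X 1) = C ζ⁻¹ * X 1) (m : Fin 2 →₀ ℕ)
    (p : MvPolynomial (Fin 2) ℂ) :
    coeff m (σ p) = ζ ^ m 0 * ζ⁻¹ ^ m 1 * coeff m p := by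
  induction p using MvPolynomial.induction_on' with
  | monomial u a =>
    rw [sigma_mono_aux ζ σ h1 h2, coeff_monomial, coeff_monomial]
    split_ifs with h
    · rw [h]
    · simp
  | add p q hp hq => rw [map_add, coeff_add, coeff_add, hp, hq]; ring

/-- The invariants of ℂ[z₁,z₂] under the automorphism z₁ ↦ ζ z₁, z₂ ↦ ζ⁻¹ z₂,
for ζ a primitive n-th root of unity, form the subalgebra generated by
z₁z₂, z₁ⁿ and z₂ⁿ. -/
theorem stmt1 (n : ℕ) (hn : 1 ≤ n) (ζ : ℂ) (hζ : IsPrimitiveRoot ζ n)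
    (σ : MvPolynomial (Fin 2) ℂ ≃ₐ[ℂ] MvPolynomial (Fin 2) ℂ)
    (h1 : σ (X 0) = C ζ * X 0) (h2 : σ (X 1) = C ζ⁻¹ * X 1) :
    {p : MvPolynomial (Fin 2) ℂ | σ p = p} =
      ↑(Algebra.adjoin ℂ
        ({X 0 * X 1, X 0 ^ n, X 1 ^ n} : Set (MvPolynomial (Fin 2) ℂ))) := by
  have hz : ζ ≠ 0 := hζ.ne_zero (by omega)
  ext p
  simp only [Set.mem_setOf_eq, SetLike.mem_coe]
  constructor
  · intro hp
    set A := Algebra.adjoin ℂ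
        ({X 0 * X 1, X 0 ^ n, X 1 ^ n} : Set (MvPolynomial (Fin 2) ℂ)) with hA
    have g1 : (X 0 * X 1 : MvPolynomial (Fin 2) ℂ) ∈ A := Algebra.subset_adjoin (by simp)
    have g2 : (X 0 ^ n : MvPolynomial (Fin 2) ℂ) ∈ A := Algebra.subset_adjoin (by simp)
    have g3 : (X 1 ^ n : MvPolynomial (Fin 2) ℂ) ∈ A := Algebra.subset_adjoin (by simp)
    rw [p.as_sum]
    refine Subalgebra.sum_mem _ fun m hm => ?_
    have hc := coeff_sigma_aux ζ σ h1 h2 m p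
    rw [hp] at hc
    have hne : coeff m p ≠ 0 := mem_support_iff.mp hm
    have h3 : ζ ^ m 0 * ζ⁻¹ ^ m 1 = 1 := by
      apply mul_right_cancel₀ hne
      rw [← hc, one_mul]
    have h4 : ζ ^ m 0 = ζ ^ m 1 := by
      rw [inv_pow] at h3
      field_simp at h3
      exact h3
    rw [mono_eq_aux]
    refine A.mul_mem (A.algebraMap_mem _) ?_
    rcases le_total (m 1) (m 0) with h | h
    · obtain ⟨k, hk⟩ := Nat.exists_eq_add_of_le h
      rw [hk, pow_add] at h4
      have h5 : ζ ^ k = 1 := mul_left_cancel₀ (pow_ne_zero (m 1) hz) (by rw [h4, mul_one])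
      obtain ⟨j, rfl⟩ := hζ.dvd_of_pow_eq_one k h5
      have : (X 0 ^ m 0 * X 1 ^ m 1 : MvPolynomial (Fin 2) ℂ)
          = (X 0 * X 1) ^ m 1 * (X 0 ^ n) ^ j := by
        rw [hk, pow_add, pow_mul]; ring
      rw [this]
      exact A.mul_mem (A.pow_mem g1 _) (A.pow_mem g2 _)
    · obtain ⟨k, hk⟩ := Nat.exists_eq_add_of_le h
      rw [hk, pow_add] at h4
      have h5 : ζ ^ k = 1 := mul_left_cancel₀ (pow_ne_zero (m 0) hz) (by rw [← h4, mul_one])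
      obtain ⟨j, rfl⟩ := hζ.dvd_of_pow_eq_one k h5
      have : (X 0 ^ m 0 * X 1 ^ m 1 : MvPolynomial (Fin 2) ℂ)
          = (X 0 * X 1) ^ m 0 * (X 1 ^ n) ^ j := by
        rw [hk, pow_add, pow_mul]; ring
      rw [this]
      exact A.mul_mem (A.pow_mem g1 _) (A.pow_mem g3 _)
  · intro hp
    induction hp using Algebra.adjoin_induction with
    | mem x hx =>
      simp only [Set.mem_insert_iff, Set.mem_singleton_iff] at hx
      rcases hx with rfl | rfl | rfl
      · rw [map_mul, h1, h2]
        have : (C ζ * C ζ⁻¹ : MvPolynomial (Fin 2) ℂ) = 1 := by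
          rw [← C_mul, mul_inv_cancel₀ hz, C_1]
        linear_combination (X 0 * X 1) * this
      · rw [map_pow, h1, mul_pow, ← C_pow, hζ.pow_eq_one, C_1, one_mul]
      · rw [map_pow, h2, mul_pow, ← C_pow, inv_pow, hζ.pow_eq_one, inv_one, C_1, one_mul]
    | algebraMap r => exact σ.commutes r
    | add x y _ _ hx hy => rw [map_add, hx, hy]
    | mul x y _ _ hx hy => rw [map_mul, hx, hy]
end

section
/- Let n ≥ 1 be an integer. The ℂ-algebra homomorphism ev : ℂ[X, Y, Z] → ℂ[z₁, z₂] determined by ev(X) = z₁z₂, ev(Y) = z₁ⁿ and ev(Z) = z₂ⁿ has kernel equal to the ideal of ℂ[X, Y, Z] generated by the single polynomial Xⁿ − Y·Z. -/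
open MvPolynomial

/-- The kernel of the evaluation X ↦ z₁z₂, Y ↦ z₁ⁿ, Z ↦ z₂ⁿ is the principal
ideal generated by Xⁿ − Y·Z. -/
theorem stmt2 (n : ℕ) (hn : 1 ≤ n) :
    RingHom.ker (MvPolynomial.aeval
        (![X 0 * X 1, X 0 ^ n, X 1 ^ n] : Fin 3 → MvPolynomial (Fin 2) ℂ) :
        MvPolynomial (Fin 3) ℂ →ₐ[ℂ] MvPolynomial (Fin 2) ℂ) =
      Ideal.span {(X 0 : MvPolynomial (Fin 3) ℂ) ^ n - X 1 * X 2} := by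
  apply le_antisymm
  · set I := Ideal.span {(X 0 : MvPolynomial (Fin 3) ℂ) ^ n - X 1 * X 2} with hI
    set ev := (MvPolynomial.aeval
        (![X 0 * X 1, X 0 ^ n, X 1 ^ n] : Fin 3 → MvPolynomial (Fin 2) ℂ) :
        MvPolynomial (Fin 3) ℂ →ₐ[ℂ] MvPolynomial (Fin 2) ℂ) with hev
    let π : MvPolynomial (Fin 3) ℂ →ₐ[ℂ] (MvPolynomial (Fin 3) ℂ ⧸ I) := Ideal.Quotient.mkₐ ℂ I
    have hrel : π (X 0) ^ n = π (X 1) * π (X 2) := by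
      rw [← map_pow, ← map_mul]
      exact Ideal.Quotient.eq.mpr (Ideal.subset_span rfl)
    let S : MvPolynomial (Fin 2) ℂ →ₗ[ℂ] (MvPolynomial (Fin 3) ℂ ⧸ I) :=
      (basisMonomials (Fin 2) ℂ).constr ℂ fun s =>
        π (X 0) ^ (min (s 0) (s 1)) * π (X 1) ^ ((s 0 - s 1) / n) * π (X 2) ^ ((s 1 - s 0) / n)
    have hS : ∀ s : Fin 2 →₀ ℕ, S (monomial s 1) =
        π (X 0) ^ (min (s 0) (s 1)) * π (X 1) ^ ((s 0 - s 1) / n) *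
          π (X 2) ^ ((s 1 - s 0) / n) := by
      intro s
      have := (basisMonomials (Fin 2) ℂ).constr_basis ℂ (fun s : Fin 2 →₀ ℕ =>
        π (X 0) ^ (min (s 0) (s 1)) * π (X 1) ^ ((s 0 - s 1) / n) *
          π (X 2) ^ ((s 1 - s 0) / n)) s
      rwa [coe_basisMonomials] at this
    have key : S ∘ₗ ev.toLinearMap = π.toLinearMap := by
      apply (basisMonomials (Fin 3) ℂ).ext
      intro s
      have h3 : (monomial s (1 : ℂ)) = X 0 ^ s 0 * X 1 ^ s 1 * X 2 ^ s 2 := by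
        rw [monomial_eq, Finsupp.prod_fintype _ _ (by simp)]
        simp [Fin.prod_univ_three]
      have h2 : ev (monomial s 1) = monomial
          (Finsupp.single 0 (s 0 + n * s 1) + Finsupp.single 1 (s 0 + n * s 2)) 1 := by
        rw [← one_mul (1 : ℂ), ← monomial_mul, ← X_pow_eq_monomial, ← X_pow_eq_monomial,
          one_mul, h3]
        simp [hev]
        ring
      rw [coe_basisMonomials]
      simp only [LinearMap.comp_apply, AlgHom.toLinearMap_apply]
      rw [h2, hS, h3]
      simp only [map_mul, map_pow]
      simp only [Finsupp.add_apply, Finsupp.single_apply]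
      generalize s 0 = a
      generalize s 1 = b
      generalize s 2 = c
      simp only [if_true, zero_ne_one, one_ne_zero, if_false, add_zero, zero_add,
        Nat.add_sub_add_left, ← Nat.mul_sub, Nat.mul_div_cancel_left _ hn,
        min_add_add_left]
      rcases le_total b c with h | h
      · obtain ⟨d, rfl⟩ := Nat.exists_eq_add_of_le h
        rw [min_eq_left (by gcongr), pow_add, pow_mul, hrel]
        simp
        ring
      · obtain ⟨d, rfl⟩ := Nat.exists_eq_add_of_le h
        rw [min_eq_right (by gcongr), pow_add, pow_mul, hrel]
        simp
        ring
    intro f hf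
    have hf0 : ev f = 0 := hf
    have := LinearMap.congr_fun key f
    simp only [LinearMap.comp_apply, AlgHom.toLinearMap_apply, hf0, map_zero] at this
    exact Ideal.Quotient.eq_zero_iff_mem.mp this.symm
  · rw [Ideal.span_le, Set.singleton_subset_iff]
    simp [RingHom.mem_ker, mul_pow]
end

section
/- For i ∈ {0,1,3,4} let φᵢᵃ be a 2×1 complex matrix and φᵢᵇ a 1×2 complex matrix, and let µ₀, µ₁, µ₂, µ₃, µ₄ ∈ ℂ satisfy µ₀ + µ₁ + 2µ₂ + µ₃ + µ₄ = 0, φᵢᵇφᵢᵃ = −µᵢ (as a scalar) for each i ∈ {0,1,3,4}, and φ₀ᵃφ₀ᵇ + φ₁ᵃφ₁ᵇ + φ₃ᵃφ₃ᵇ + φ₄ᵃφ₄ᵇ = µ₂·I₂. For indices i, j define p_{ij} = Tr(φᵢᵃφᵢᵇφⱼᵃφⱼᵇ). Then for any i ∈ {0,1,3,4}, if j, k, l are the three other elements of {0,1,3,4}, one has p_{ij} + p_{ik} + p_{il} = −µᵢ·(µᵢ + µ₂). -/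
/-- The degree-4 trace p_{ij} = Tr(φᵢᵃφᵢᵇφⱼᵃφⱼᵇ) of the McKay quiver of type D₄. -/
noncomputable def quiverP8 (φa : Fin 5 → Matrix (Fin 2) (Fin 1) ℂ)
    (φb : Fin 5 → Matrix (Fin 1) (Fin 2) ℂ) (i j : Fin 5) : ℂ :=
  Matrix.trace (φa i * φb i * (φa j * φb j))

/-- Degree-4 trace relations on the fibre of the moment map for the McKay
quiver of type D₄: for i ∈ {0,1,3,4} and j,k,l the three other indices,
p_{ij} + p_{ik} + p_{il} = −μᵢ(μᵢ + μ₂). -/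
theorem stmt8 (φa : Fin 5 → Matrix (Fin 2) (Fin 1) ℂ)
    (φb : Fin 5 → Matrix (Fin 1) (Fin 2) ℂ) (μ : Fin 5 → ℂ)
    (hsum : μ 0 + μ 1 + 2 * μ 2 + μ 3 + μ 4 = 0)
    (hscal : ∀ i ∈ ({0, 1, 3, 4} : Finset (Fin 5)), (φb i * φa i) 0 0 = -μ i)
    (hmom : φa 0 * φb 0 + φa 1 * φb 1 + φa 3 * φb 3 + φa 4 * φb 4
      = μ 2 • (1 : Matrix (Fin 2) (Fin 2) ℂ)) :
    ∀ i j k l : Fin 5, ({i, j, k, l} : Finset (Fin 5)) = {0, 1, 3, 4} →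
      quiverP8 φa φb i j + quiverP8 φa φb i k + quiverP8 φa φb i l
        = -μ i * (μ i + μ 2) := by
  intro i j k l h
  have hd : i ≠ j ∧ i ≠ k ∧ i ≠ l ∧ j ≠ k ∧ j ≠ l ∧ k ≠ l := by
    revert h
    clear hmom hscal hsum
    revert i j k l
    decide +kernel
  obtain ⟨h1, h2, h3, h4, h5, h6⟩ := hd
  have hi : i ∈ ({0, 1, 3, 4} : Finset (Fin 5)) := by rw [← h]; simp
  have hs := hscal i hi
  have htr : Matrix.trace (φa i * φb i) = -μ i := by
    rw [Matrix.trace_mul_comm, ← hs]; simp [Matrix.trace]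
  have hm : ∑ x ∈ ({0, 1, 3, 4} : Finset (Fin 5)), φa x * φb x
      = μ 2 • (1 : Matrix (Fin 2) (Fin 2) ℂ) := by
    rw [← hmom]
    rw [Finset.sum_insert (by decide), Finset.sum_insert (by decide),
      Finset.sum_insert (by decide), Finset.sum_singleton]
    simp only [add_assoc]
  rw [← h, Finset.sum_insert (by simp [h1, h2, h3]), Finset.sum_insert (by simp [h4, h5]),
    Finset.sum_insert (by simp [h6]), Finset.sum_singleton] at hm
  have ht := congrArg (fun M => Matrix.trace (φa i * φb i * M)) hm
  simp only [Matrix.mul_add, Matrix.trace_add, Matrix.mul_smul, Matrix.mul_one,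
    Matrix.trace_smul, htr, smul_eq_mul] at ht
  have hii : Matrix.trace (φa i * φb i * (φa i * φb i)) = μ i * μ i := by
    rw [Matrix.mul_apply] at hs
    simp [Fin.sum_univ_two, Matrix.trace, Matrix.mul_apply] at hs ⊢
    linear_combination (φb i 0 0 * φa i 0 0 + φb i 0 1 * φa i 1 0 - μ i) * hs
  unfold quiverP8
  linear_combination ht - hii
end

section
/- For i ∈ {0,1,3,4} let φᵢᵃ be a 2×1 complex matrix and φᵢᵇ a 1×2 complex matrix, and let µ₀, µ₁, µ₂, µ₃, µ₄ ∈ ℂ satisfy µ₀ + µ₁ + 2µ₂ + µ₃ + µ₄ = 0, φᵢᵇφᵢᵃ = −µᵢ (as a scalar) for each i ∈ {0,1,3,4}, and φ₀ᵃφ₀ᵇ + φ₁ᵃφ₁ᵇ + φ₃ᵃφ₃ᵇ + φ₄ᵃφ₄ᵇ = µ₂·I₂. For indices i, j, k define p_{ij} = Tr(φᵢᵃφᵢᵇφⱼᵃφⱼᵇ) and q_{ijk} = Tr(φₖᵃφₖᵇ·φⱼᵃφⱼᵇ·φᵢᵃφᵢᵇ). Then (1) q_{iji} = −µᵢ·p_{ij}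 for all i, j ∈ {0,1,3,4}, and (2) whenever {i,j,k,l} = {0,1,3,4}, one has q_{ijk} + q_{ijl} = (µᵢ + µⱼ + µ₂)·p_{ij}. -/
/-- The degree-4 trace p_{ij} = Tr(φᵢᵃφᵢᵇφⱼᵃφⱼᵇ) of the McKay quiver of type D₄. -/
noncomputable def quiverP9 (φa : Fin 5 → Matrix (Fin 2) (Fin 1) ℂ)
    (φb : Fin 5 → Matrix (Fin 1) (Fin 2) ℂ) (i j : Fin 5) : ℂ :=
  Matrix.trace (φa i * φb i * (φa j * φb j))

/-- The degree-6 trace q_{ijk} = Tr(φₖᵃφₖᵇ·φⱼᵃφⱼᵇ·φᵢᵃφᵢᵇ). -/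
noncomputable def quiverQ9 (φa : Fin 5 → Matrix (Fin 2) (Fin 1) ℂ)
    (φb : Fin 5 → Matrix (Fin 1) (Fin 2) ℂ) (i j k : Fin 5) : ℂ :=
  Matrix.trace (φa k * φb k * (φa j * φb j) * (φa i * φb i))

/-- Degree-6 trace relations on the fibre of the moment map for the McKay
quiver of type D₄: q_{iji} = −μᵢ p_{ij}, and q_{ijk} + q_{ijl} = (μᵢ+μⱼ+μ₂) p_{ij}
whenever {i,j,k,l} = {0,1,3,4}. -/
theorem stmt9 (φa : Fin 5 → Matrix (Fin 2) (Fin 1) ℂ)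
    (φb : Fin 5 → Matrix (Fin 1) (Fin 2) ℂ) (μ : Fin 5 → ℂ)
    (hsum : μ 0 + μ 1 + 2 * μ 2 + μ 3 + μ 4 = 0)
    (hscal : ∀ i ∈ ({0, 1, 3, 4} : Finset (Fin 5)), (φb i * φa i) 0 0 = -μ i)
    (hmom : φa 0 * φb 0 + φa 1 * φb 1 + φa 3 * φb 3 + φa 4 * φb 4
      = μ 2 • (1 : Matrix (Fin 2) (Fin 2) ℂ)) :
    (∀ i ∈ ({0, 1, 3, 4} : Finset (Fin 5)), ∀ j ∈ ({0, 1, 3, 4} : Finset (Fin 5)),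
        quiverQ9 φa φb i j i = -μ i * quiverP9 φa φb i j) ∧
    (∀ i j k l : Fin 5, ({i, j, k, l} : Finset (Fin 5)) = {0, 1, 3, 4} →
        quiverQ9 φa φb i j k + quiverQ9 φa φb i j l
          = (μ i + μ j + μ 2) * quiverP9 φa φb i j) := by
  have hX : ∀ i ∈ ({0, 1, 3, 4} : Finset (Fin 5)),
      φa i * φb i * (φa i * φb i) = (-μ i) • (φa i * φb i) := by
    intro i hi
    have h1 : φb i * φa i = (-μ i) • (1 : Matrix (Fin 1) (Fin 1) ℂ) := by
      ext a b
      rw [Subsingleton.elim a 0, Subsingleton.elim b 0, hscal i hi]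
      simp
    calc φa i * φb i * (φa i * φb i) = φa i * (φb i * φa i) * φb i := by
          simp only [Matrix.mul_assoc]
      _ = _ := by rw [h1]; simp
  have h1 : ∀ i ∈ ({0, 1, 3, 4} : Finset (Fin 5)), ∀ j : Fin 5,
        quiverQ9 φa φb i j i = -μ i * quiverP9 φa φb i j := by
    intro i hi j
    unfold quiverQ9 quiverP9
    rw [Matrix.trace_mul_comm, ← Matrix.mul_assoc, hX i hi, Matrix.smul_mul, Matrix.trace_smul,
      smul_eq_mul]
  refine ⟨fun i hi j _ => h1 i hi j, ?_⟩
  intro i j k l h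
  have hi : i ∈ ({0, 1, 3, 4} : Finset (Fin 5)) := by rw [← h]; simp
  have hj : j ∈ ({0, 1, 3, 4} : Finset (Fin 5)) := by rw [← h]; simp
  have hd : ∀ i j k l : Fin 5, ({i, j, k, l} : Finset (Fin 5)) = {0, 1, 3, 4} →
      i ∉ ({j, k, l} : Finset (Fin 5)) ∧ j ∉ ({k, l} : Finset (Fin 5)) ∧
      k ∉ ({l} : Finset (Fin 5)) := by decide +kernel
  obtain ⟨d1, d2, d3⟩ := hd i j k l h
  have hs : φa i * φb i + (φa j * φb j + (φa k * φb k + φa l * φb l))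
      = μ 2 • (1 : Matrix (Fin 2) (Fin 2) ℂ) := by
    have e : ∑ x ∈ ({i, j, k, l} : Finset (Fin 5)), φa x * φb x
        = ∑ x ∈ ({0, 1, 3, 4} : Finset (Fin 5)), φa x * φb x := by rw [h]
    rw [Finset.sum_insert d1, Finset.sum_insert d2, Finset.sum_insert d3,
      Finset.sum_singleton] at e
    rw [e, ← hmom, Finset.sum_insert (by decide), Finset.sum_insert (by decide),
      Finset.sum_insert (by decide), Finset.sum_singleton]
    simp only [add_assoc]
  have hq := congrArg (fun M => Matrix.trace (M * (φa j * φb j) * (φa i * φb i))) hs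
  simp only [Matrix.add_mul, Matrix.trace_add, Matrix.smul_mul, Matrix.one_mul,
    Matrix.trace_smul, smul_eq_mul] at hq
  have hii := h1 i hi j
  have hjj := hX j hj
  unfold quiverQ9 at hii ⊢
  rw [hjj, Matrix.smul_mul, Matrix.trace_smul, smul_eq_mul,
    Matrix.trace_mul_comm (φa j * φb j) (φa i * φb i)] at hq
  unfold quiverP9 at hii ⊢
  linear_combination hq - hii
end

section
/- For i ∈ {0,1,3,4} let φᵢᵃ be a 2×1 complex matrix and φᵢᵇ a 1×2 complex matrix, and let µ₀, µ₁, µ₂, µ₃, µ₄ ∈ ℂ satisfy µ₀ + µ₁ + 2µ₂ + µ₃ + µ₄ = 0, φᵢᵇφᵢᵃ = −µᵢ (as a scalar) for each i ∈ {0,1,3,4}, and φ₀ᵃφ₀ᵇ + φ₁ᵃφ₁ᵇ + φ₃ᵃφ₃ᵇ + φ₄ᵃφ₄ᵇ = µ₂·I₂. Define p_{ij} = Tr(φᵢᵃφᵢᵇφⱼᵃφⱼᵇ), q_{034} = Tr(φ₄ᵃφ₄ᵇφ₃ᵃφ₃ᵇφ₀ᵃφ₀ᵇ), C = µ₃(µ₂+µ₃)(µ₁+µ₂+µ₃),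 q' = q_{034} − ½·(p_{03}(µ₃−µ₄) + p_{34}(µ₃−µ₀) + C), p₀₃' = p_{03} + ¼(µ₃−µ₀)², p₃₄' = p_{34} + ¼(µ₃−µ₄)², and 𝒜 = −µ₁µ₂ − µ₂µ₃ − µ₂µ₄ − µ₂² − ½µ₁µ₄ − ½µ₁µ₃ − ½µ₃µ₄ − ½µ₁² − ½µ₃² − ½µ₄², ℬ = (1/16)(µ₃−µ₄)(µ₃+µ₄)(2µ₂+µ₃+µ₄)(2µ₁+2µ₂+µ₃+µ₄), 𝒞 = (1/16)(µ₁−µ₄)(µ₁+µ₄)(2µ₂+µ₁+µ₄)(2µ₃+2µ₂+µ₁+µ₄), 𝒟 = −(1/32)(2µ₁µ₂+µ₁µ₃+µ₁µ₄+2µ₂²+2µ₂µ₃+2µ₂µ₄+µ₃µ₄+µ₄²)·(µ₁µ₃+µ₁µ₄+2µ₂µ₄+µ₃µ₄+µ₄²)·(µ₁µ₃−µ₁µ₄−2µ₂µ₄−µ₃µ₄−µ₄²). Then q'² = p₀₃'·p₃₄'·(p₀₃' + p₃₄') + 𝒜·p₀₃'·p₃₄' + ℬ·p₀₃' + 𝒞·p₃₄'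 + 𝒟. -/
theorem aux_rel (p r s q t μ0 μ1 μ2 μ3 μ4 : ℂ)
    (hsum : μ0 + μ1 + 2 * μ2 + μ3 + μ4 = 0)
    (hK : 2 * (p + r + s) = 2 * μ2 ^ 2 + 2 * μ2 * μ1 + μ1 ^ 2 - μ0 ^ 2 - μ3 ^ 2 - μ4 ^ 2)
    (hS : q + t = -μ4 * p - μ3 * s - μ0 * r + μ0 * μ3 * μ4)
    (hP : q * t = p * r * s) :
    (q - (1/2) * (p * (μ3 - μ4) + r * (μ3 - μ0) + μ3 * (μ2 + μ3) * (μ1 + μ2 + μ3))) ^ 2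
      = (p + (1/4) * (μ3 - μ0) ^ 2) * (r + (1/4) * (μ3 - μ4) ^ 2)
        * ((p + (1/4) * (μ3 - μ0) ^ 2) + (r + (1/4) * (μ3 - μ4) ^ 2))
      + (-μ1 * μ2 - μ2 * μ3 - μ2 * μ4 - μ2 ^ 2 - (1/2) * μ1 * μ4
      - (1/2) * μ1 * μ3 - (1/2) * μ3 * μ4 - (1/2) * μ1 ^ 2 - (1/2) * μ3 ^ 2
      - (1/2) * μ4 ^ 2) * (p + (1/4) * (μ3 - μ0) ^ 2) * (r + (1/4) * (μ3 - μ4) ^ 2)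
      + ((1/16) * (μ3 - μ4) * (μ3 + μ4) * (2 * μ2 + μ3 + μ4)
      * (2 * μ1 + 2 * μ2 + μ3 + μ4)) * (p + (1/4) * (μ3 - μ0) ^ 2)
      + ((1/16) * (μ1 - μ4) * (μ1 + μ4) * (2 * μ2 + μ1 + μ4)
      * (2 * μ3 + 2 * μ2 + μ1 + μ4)) * (r + (1/4) * (μ3 - μ4) ^ 2)
      + (-(1/32) * (2 * μ1 * μ2 + μ1 * μ3 + μ1 * μ4 + 2 * μ2 ^ 2
        + 2 * μ2 * μ3 + 2 * μ2 * μ4 + μ3 * μ4 + μ4 ^ 2)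
      * (μ1 * μ3 + μ1 * μ4 + 2 * μ2 * μ4 + μ3 * μ4 + μ4 ^ 2)
      * (μ1 * μ3 - μ1 * μ4 - 2 * μ2 * μ4 - μ3 * μ4 - μ4 ^ 2)) := by
  have e0 : μ0 = -μ1 - 2 * μ2 - μ3 - μ4 := by linear_combination hsum
  subst e0
  have es : s = (2 * μ2 ^ 2 + 2 * μ2 * μ1 + μ1 ^ 2 - (-μ1 - 2 * μ2 - μ3 - μ4) ^ 2
      - μ3 ^ 2 - μ4 ^ 2) / 2 - p - r := by linear_combination hK / 2
  subst es
  linear_combination q * hS - hP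

/-- The single relation q'² = p₀₃'p₃₄'(p₀₃'+p₃₄') + 𝒜p₀₃'p₃₄' + ℬp₀₃' + 𝒞p₃₄' + 𝒟
among the generators of the invariant ring on the fibre of the moment map for
the McKay quiver of type D₄. -/
theorem stmt11 (a0 a1 a3 a4 : Matrix (Fin 2) (Fin 1) ℂ)
    (b0 b1 b3 b4 : Matrix (Fin 1) (Fin 2) ℂ) (μ0 μ1 μ2 μ3 μ4 : ℂ)
    (hsum : μ0 + μ1 + 2 * μ2 + μ3 + μ4 = 0)
    (h0 : (b0 * a0) 0 0 = -μ0) (h1 : (b1 * a1) 0 0 = -μ1)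
    (h3 : (b3 * a3) 0 0 = -μ3) (h4 : (b4 * a4) 0 0 = -μ4)
    (hmom : a0 * b0 + a1 * b1 + a3 * b3 + a4 * b4
      = μ2 • (1 : Matrix (Fin 2) (Fin 2) ℂ))
    (p03 p34 q034 C q' p03' p34' 𝒜 ℬ 𝒞 𝒟 : ℂ)
    (hp03 : p03 = Matrix.trace (a0 * b0 * (a3 * b3)))
    (hp34 : p34 = Matrix.trace (a3 * b3 * (a4 * b4)))
    (hq034 : q034 = Matrix.trace (a4 * b4 * (a3 * b3) * (a0 * b0)))
    (hC : C = μ3 * (μ2 + μ3) * (μ1 + μ2 + μ3))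
    (hq' : q' = q034 - (1/2) * (p03 * (μ3 - μ4) + p34 * (μ3 - μ0) + C))
    (hp03' : p03' = p03 + (1/4) * (μ3 - μ0) ^ 2)
    (hp34' : p34' = p34 + (1/4) * (μ3 - μ4) ^ 2)
    (hA : 𝒜 = -μ1 * μ2 - μ2 * μ3 - μ2 * μ4 - μ2 ^ 2 - (1/2) * μ1 * μ4
      - (1/2) * μ1 * μ3 - (1/2) * μ3 * μ4 - (1/2) * μ1 ^ 2 - (1/2) * μ3 ^ 2
      - (1/2) * μ4 ^ 2)
    (hB : ℬ = (1/16) * (μ3 - μ4) * (μ3 + μ4) * (2 * μ2 + μ3 + μ4)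
      * (2 * μ1 + 2 * μ2 + μ3 + μ4))
    (hC' : 𝒞 = (1/16) * (μ1 - μ4) * (μ1 + μ4) * (2 * μ2 + μ1 + μ4)
      * (2 * μ3 + 2 * μ2 + μ1 + μ4))
    (hD : 𝒟 = -(1/32) * (2 * μ1 * μ2 + μ1 * μ3 + μ1 * μ4 + 2 * μ2 ^ 2
        + 2 * μ2 * μ3 + 2 * μ2 * μ4 + μ3 * μ4 + μ4 ^ 2)
      * (μ1 * μ3 + μ1 * μ4 + 2 * μ2 * μ4 + μ3 * μ4 + μ4 ^ 2)
      * (μ1 * μ3 - μ1 * μ4 - 2 * μ2 * μ4 - μ3 * μ4 - μ4 ^ 2)) :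
    q' ^ 2 = p03' * p34' * (p03' + p34') + 𝒜 * p03' * p34' + ℬ * p03' + 𝒞 * p34' + 𝒟 := by
  have m00 := congrFun (congrFun hmom 0) 0
  have m01 := congrFun (congrFun hmom 0) 1
  have m10 := congrFun (congrFun hmom 1) 0
  have m11 := congrFun (congrFun hmom 1) 1
  simp [Matrix.mul_apply, Matrix.trace, Fin.sum_univ_two] at h0 h1 h3 h4 hp03 hp34 hq034 m00 m01 m10 m11
  subst hp03' hp34' hq' hA hB hC' hD hC
  generalize a0 0 0 = x0 at *
  generalize a0 1 0 = y0 at *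
  generalize b0 0 0 = u0 at *
  generalize b0 0 1 = v0 at *
  generalize a1 0 0 = x1 at *
  generalize a1 1 0 = y1 at *
  generalize b1 0 0 = u1 at *
  generalize b1 0 1 = v1 at *
  generalize a3 0 0 = x3 at *
  generalize a3 1 0 = y3 at *
  generalize b3 0 0 = u3 at *
  generalize b3 0 1 = v3 at *
  generalize a4 0 0 = x4 at *
  generalize a4 1 0 = y4 at *
  generalize b4 0 0 = u4 at *
  generalize b4 0 1 = v4 at *
  clear hmom
  have g0 : μ0 = -(u0 * x0 + v0 * y0) := by linear_combination h0
  have g1 : μ1 = -(u1 * x1 + v1 * y1) := by linear_combination h1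
  have g3 : μ3 = -(u3 * x3 + v3 * y3) := by linear_combination h3
  have g4 : μ4 = -(u4 * x4 + v4 * y4) := by linear_combination h4
  refine aux_rel p03 p34 ((u0 * x4 + v0 * y4) * (u4 * x0 + v4 * y0)) q034
    ((u0 * x3 + v0 * y3) * (u3 * x4 + v3 * y4) * (u4 * x0 + v4 * y0)) μ0 μ1 μ2 μ3 μ4 hsum ?_ ?_ ?_
  · rw [hp03, hp34, g0, g1, g3, g4]
    linear_combination (x0*u0+x3*u3+x4*u4 + μ2 - x1*u1) * m00
      + (y0*v0+y3*v3+y4*v4 + μ2 - y1*v1) * m11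
      + 2 * (y0*u0+y3*u3+y4*u4) * m01 - 2 * x1 * v1 * m10
  · rw [hp03, hp34, hq034, g0, g3, g4]
    ring
  · rw [hp03, hp34, hq034]
    ring
end

section
/- Let σ be the ℂ-algebra automorphism of the polynomial ring ℂ[x, y, z] determined by σ(x) = y, σ(y) = x, σ(z) = −z. Then the subalgebra of σ-invariant polynomials {p ∈ ℂ[x, y, z] | σ(p) = p} is exactly the ℂ-subalgebra generated by x + y, x·y, z², and z·(x − y). -/
open MvPolynomial

/-- The invariants of ℂ[x,y,z] under the automorphism x ↦ y, y ↦ x, z ↦ −z form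
the subalgebra generated by x + y, xy, z² and z(x − y). -/
theorem stmt13 (σ : MvPolynomial (Fin 3) ℂ ≃ₐ[ℂ] MvPolynomial (Fin 3) ℂ)
    (hx : σ (X 0) = X 1) (hy : σ (X 1) = X 0) (hz : σ (X 2) = -X 2) :
    {p : MvPolynomial (Fin 3) ℂ | σ p = p} =
      ↑(Algebra.adjoin ℂ
        ({X 0 + X 1, X 0 * X 1, X 2 ^ 2, X 2 * (X 0 - X 1)} :
          Set (MvPolynomial (Fin 3) ℂ))) := by
  set A := Algebra.adjoin ℂ
        ({X 0 + X 1, X 0 * X 1, X 2 ^ 2, X 2 * (X 0 - X 1)} :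
          Set (MvPolynomial (Fin 3) ℂ)) with hA
  have inv : ∀ a ∈ A, σ a = a := by
    intro a ha
    induction ha using Algebra.adjoin_induction with
    | mem x h =>
      rcases h with rfl | rfl | rfl | rfl <;> simp [hx, hy, hz] <;> ring
    | algebraMap r => exact σ.commutes r
    | add x y _ _ h1 h2 => rw [map_add, h1, h2]
    | mul x y _ _ h1 h2 => rw [map_mul, h1, h2]
  have m1 : (X 0 + X 1 : MvPolynomial (Fin 3) ℂ) ∈ A := Algebra.subset_adjoin (by simp)
  have m2 : (X 0 * X 1 : MvPolynomial (Fin 3) ℂ) ∈ A := Algebra.subset_adjoin (by simp)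
  have m3 : (X 2 ^ 2 : MvPolynomial (Fin 3) ℂ) ∈ A := Algebra.subset_adjoin (by simp)
  have m4 : (X 2 * (X 0 - X 1) : MvPolynomial (Fin 3) ℂ) ∈ A :=
    Algebra.subset_adjoin (by simp)
  have mC : ∀ r : ℂ, (C r : MvPolynomial (Fin 3) ℂ) ∈ A := fun r => A.algebraMap_mem r
  have hh : (C (1/2) : MvPolynomial (Fin 3) ℂ) * 2 = 1 := by
    rw [show (2 : MvPolynomial (Fin 3) ℂ) = C 2 from (map_ofNat C 2).symm, ← C_mul]
    norm_num
  have m5 : ((X 0 - X 1) ^ 2 : MvPolynomial (Fin 3) ℂ) ∈ A := by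
    have : ((X 0 - X 1) ^ 2 : MvPolynomial (Fin 3) ℂ)
      = (X 0 + X 1) ^ 2 - (X 0 * X 1 + X 0 * X 1 + X 0 * X 1 + X 0 * X 1) := by ring
    rw [this]
    exact sub_mem (pow_mem m1 2) (add_mem (add_mem (add_mem m2 m2) m2) m2)
  have dec : ∀ p : MvPolynomial (Fin 3) ℂ, ∃ a ∈ A, ∃ b ∈ A, ∃ c ∈ A,
      p = a + b * (X 0 - X 1) + c * X 2 := by
    intro p
    induction p using MvPolynomial.induction_on with
    | C r => exact ⟨C r, mC r, 0, zero_mem _, 0, zero_mem _, by ring⟩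
    | add p q hp hq =>
      obtain ⟨a, ha, b, hb, c, hc, rfl⟩ := hp
      obtain ⟨a', ha', b', hb', c', hc', rfl⟩ := hq
      exact ⟨a + a', add_mem ha ha', b + b', add_mem hb hb', c + c', add_mem hc hc', by ring⟩
    | mul_X p i hp =>
      obtain ⟨a, ha, b, hb, c, hc, rfl⟩ := hp
      have k := mC (1/2)
      have e1 := add_mem (mul_mem hb m5) (mul_mem hc m4)
      fin_cases i
      · refine ⟨C (1/2) * (a * (X 0 + X 1) + (b * (X 0 - X 1) ^ 2 + c * (X 2 * (X 0 - X 1)))),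
          mul_mem k (add_mem (mul_mem ha m1) e1),
          C (1/2) * (b * (X 0 + X 1) + a), mul_mem k (add_mem (mul_mem hb m1) ha),
          C (1/2) * (c * (X 0 + X 1)), mul_mem k (mul_mem hc m1), ?_⟩
        simp only [Fin.zero_eta]
        linear_combination (-(a + b * (X 0 - X 1) + c * X 2) * X 0) * hh
      · refine ⟨C (1/2) * (a * (X 0 + X 1) - (b * (X 0 - X 1) ^ 2 + c * (X 2 * (X 0 - X 1)))),
          mul_mem k (sub_mem (mul_mem ha m1) e1),
          C (1/2) * (b * (X 0 + X 1) - a), mul_mem k (sub_mem (mul_mem hb m1) ha),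
          C (1/2) * (c * (X 0 + X 1)), mul_mem k (mul_mem hc m1), ?_⟩
        simp only [Fin.mk_one]
        linear_combination (-(a + b * (X 0 - X 1) + c * X 2) * X 1) * hh
      · refine ⟨b * (X 2 * (X 0 - X 1)) + c * X 2 ^ 2,
          add_mem (mul_mem hb m4) (mul_mem hc m3), 0, zero_mem _, a, ha, ?_⟩
        simp only [Fin.reduceFinMk]
        ring
  ext p
  constructor
  · intro (hp : σ p = p)
    obtain ⟨a, ha, b, hb, c, hc, rfl⟩ := dec p
    have : a + b * (X 0 - X 1) + c * X 2 = a := by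
      simp only [map_add, map_mul, map_sub, hx, hy, hz, inv a ha, inv b hb, inv c hc] at hp
      linear_combination (-C (1/2)) * hp - (b * (X 0 - X 1) + c * X 2) * hh
    rw [this]; exact ha
  · exact inv p
end

section
/- For all t₂, t₄, t₆ ∈ ℂ there exists a point (X, Y, W) ∈ ℂ³ at which the polynomial f(X, Y, W) = −(1/64)X⁵ + X·Y² − W² + (t₂/32)·X⁴ + (−(3/128)t₂² − (1/32)t₄)·X³ + ((7/192)t₂t₄ + (1/32)t₆ + (7/864)t₂³)·X² + (−(1/32)t₆t₂ − (5/384)t₂²t₄ − (35/27648)t₂⁴ − (1/64)t₄²)·X + ((1/4)t₆ + (1/24)t₂t₄ + (1/432)t₂³)·Y + (1/128)t₆t₂² + (1/32)t₆t₄ + (11/6912)t₂³t₄ + (1/192)t₂t₄² + (1/13824)t₂⁵ and all three of its partial derivatives ∂f/∂X, ∂f/∂Y, ∂f/∂W vanish. -/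
/-- Every fibre of the quotient of the semiuniversal deformation of a simple
singularity of type C₃ is singular: for all t₂, t₄, t₆ there is a point where
the defining polynomial f and all its partial derivatives vanish. -/
theorem stmt16 (t₂ t₄ t₆ : ℂ) :
    ∃ X Y W : ℂ,
      -(1/64) * X ^ 5 + X * Y ^ 2 - W ^ 2 + (t₂ / 32) * X ^ 4
          + (-(3/128) * t₂ ^ 2 - (1/32) * t₄) * X ^ 3
          + ((7/192) * t₂ * t₄ + (1/32) * t₆ + (7/864) * t₂ ^ 3) * X ^ 2
          + (-(1/32) * t₆ * t₂ - (5/384) * t₂ ^ 2 * t₄ - (35/27648) * t₂ ^ 4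
              - (1/64) * t₄ ^ 2) * X
          + ((1/4) * t₆ + (1/24) * t₂ * t₄ + (1/432) * t₂ ^ 3) * Y
          + (1/128) * t₆ * t₂ ^ 2 + (1/32) * t₆ * t₄ + (11/6912) * t₂ ^ 3 * t₄
          + (1/192) * t₂ * t₄ ^ 2 + (1/13824) * t₂ ^ 5 = 0 ∧
      -(5/64) * X ^ 4 + Y ^ 2 + 4 * (t₂ / 32) * X ^ 3
          + 3 * (-(3/128) * t₂ ^ 2 - (1/32) * t₄) * X ^ 2
          + 2 * ((7/192) * t₂ * t₄ + (1/32) * t₆ + (7/864) * t₂ ^ 3) * X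
          + (-(1/32) * t₆ * t₂ - (5/384) * t₂ ^ 2 * t₄ - (35/27648) * t₂ ^ 4
              - (1/64) * t₄ ^ 2) = 0 ∧
      2 * X * Y + ((1/4) * t₆ + (1/24) * t₂ * t₄ + (1/432) * t₂ ^ 3) = 0 ∧
      -2 * W = 0 := by
  obtain ⟨X, hX⟩ : ∃ X : ℂ, 108 * X ^ 3 - 108 * X ^ 2 * t₂ + (108 * t₄ + 27 * t₂ ^ 2) * X
      - t₂ ^ 3 - 18 * t₂ * t₄ - 108 * t₆ = 0 := by
    have hd : (Polynomial.C (108 : ℂ) * Polynomial.X ^ 3 + Polynomial.C (-108 * t₂) * Polynomial.X ^ 2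
        + Polynomial.C (108 * t₄ + 27 * t₂ ^ 2) * Polynomial.X
        + Polynomial.C (- t₂ ^ 3 - 18 * t₂ * t₄ - 108 * t₆)).degree = 3 :=
      Polynomial.degree_cubic (by norm_num)
    obtain ⟨X, hX⟩ := Complex.exists_root (by rw [hd]; norm_num)
    refine ⟨X, ?_⟩
    simp only [Polynomial.IsRoot, Polynomial.eval_add, Polynomial.eval_mul, Polynomial.eval_C,
      Polynomial.eval_pow, Polynomial.eval_X] at hX
    linear_combination hX
  have h6 : t₆ = X ^ 3 - X ^ 2 * t₂ + (t₄ + t₂ ^ 2 / 4) * X - t₂ ^ 3 / 108 - t₂ * t₄ / 6 := by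
    linear_combination (-1 / 108) * hX
  clear hX
  subst h6
  refine ⟨X, -(1/32) * (4 * X ^ 2 - 4 * X * t₂ + t₂ ^ 2 + 4 * t₄), 0, ?_, ?_, ?_, ?_⟩ <;> ring
end

section
/- For all t₂, t₆ ∈ ℂ there exists a point (X, Y, Z) ∈ ℂ³ at which the polynomial f(X, Y, Z) = X³·Y − 11664·Y³ + Z² + (−(11/32)t₂⁶ − (189/4)t₂³t₆ − 729t₆²)·Y + (−(15/16)t₂⁴ − 81t₂t₆)·X·Y + 324·t₂·X·Y² + (189t₂³ + 5832t₆)·Y² and all three of its partial derivatives ∂f/∂X, ∂f/∂Y, ∂f/∂Z vanish. -/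
/-- Existence of a root of a depressed cubic over the complex numbers. -/
theorem cubic_root_exists (p q : ℂ) : ∃ x : ℂ, x ^ 3 + p * x + q = 0 := by
  have hd : (Polynomial.X ^ 3 + Polynomial.C p * Polynomial.X
      + Polynomial.C q : Polynomial ℂ).degree = 3 := by
    compute_degree!
  obtain ⟨x, hx⟩ := IsAlgClosed.exists_root (Polynomial.X ^ 3 + Polynomial.C p * Polynomial.X
      + Polynomial.C q : Polynomial ℂ) (by rw [hd]; norm_num)
  exact ⟨x, by simpa [Polynomial.IsRoot] using hx⟩

/-- Every fibre of the quotient of the semiuniversal deformation of a simple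
singularity of type G₂ is singular: for all t₂, t₆ there is a point where the
defining polynomial f and all its partial derivatives vanish. -/
theorem stmt17 (t₂ t₆ : ℂ) :
    ∃ X Y Z : ℂ,
      X ^ 3 * Y - 11664 * Y ^ 3 + Z ^ 2
          + (-(11/32) * t₂ ^ 6 - (189/4) * t₂ ^ 3 * t₆ - 729 * t₆ ^ 2) * Y
          + (-(15/16) * t₂ ^ 4 - 81 * t₂ * t₆) * X * Y
          + 324 * t₂ * X * Y ^ 2 + (189 * t₂ ^ 3 + 5832 * t₆) * Y ^ 2 = 0 ∧
      3 * X ^ 2 * Y + (-(15/16) * t₂ ^ 4 - 81 * t₂ * t₆) * Y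
          + 324 * t₂ * Y ^ 2 = 0 ∧
      X ^ 3 - 34992 * Y ^ 2
          + (-(11/32) * t₂ ^ 6 - (189/4) * t₂ ^ 3 * t₆ - 729 * t₆ ^ 2)
          + (-(15/16) * t₂ ^ 4 - 81 * t₂ * t₆) * X
          + 648 * t₂ * X * Y + 2 * (189 * t₂ ^ 3 + 5832 * t₆) * Y = 0 ∧
      2 * Z = 0 := by
  obtain ⟨x, hx⟩ := cubic_root_exists (-(15/16) * t₂ ^ 4 - 81 * t₂ * t₆)
    (-(11/32) * t₂ ^ 6 - (189/4) * t₂ ^ 3 * t₆ - 729 * t₆ ^ 2)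
  refine ⟨x, 0, 0, by ring, by ring, ?_, by ring⟩
  linear_combination hx
end

section
/- Let ω ∈ ℂ be a primitive cube root of unity and let ρ be the ℂ-algebra automorphism of the polynomial ring ℂ[X, Y, z] determined by ρ(X) = ω·X, ρ(Y) = ω²·Y, ρ(z) = z. Then the subalgebra of ρ-invariant polynomials {p ∈ ℂ[X, Y, z] | ρ(p) = p} is exactly the ℂ-subalgebra generated by X³, Y³, X·Y, and z. -/
open MvPolynomial

/-- For ω a primitive cube root of unity, the invariants of ℂ[X,Y,z] under the
automorphism X ↦ ωX, Y ↦ ω²Y, z ↦ z form the subalgebra generated by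
X³, Y³, XY and z. -/
theorem stmt19 (ω : ℂ) (hω : IsPrimitiveRoot ω 3)
    (ρ : MvPolynomial (Fin 3) ℂ ≃ₐ[ℂ] MvPolynomial (Fin 3) ℂ)
    (hX : ρ (X 0) = C ω * X 0) (hY : ρ (X 1) = C (ω ^ 2) * X 1)
    (hz : ρ (X 2) = X 2) :
    {p : MvPolynomial (Fin 3) ℂ | ρ p = p} =
      ↑(Algebra.adjoin ℂ
        ({X 0 ^ 3, X 1 ^ 3, X 0 * X 1, X 2} : Set (MvPolynomial (Fin 3) ℂ))) := by
  have h3 : ω ^ 3 = 1 := hω.pow_eq_one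
  have hC3 : (C ω : MvPolynomial (Fin 3) ℂ) ^ 3 = 1 := by rw [← C_pow, h3, C_1]
  have hC : ∀ c : ℂ, ρ (C c) = C c := fun c => ρ.commutes c
  rw [C_pow] at hY
  set S := Algebra.adjoin ℂ
        ({X 0 ^ 3, X 1 ^ 3, X 0 * X 1, X 2} : Set (MvPolynomial (Fin 3) ℂ)) with hS
  have m1 : (X 0 ^ 3 : MvPolynomial (Fin 3) ℂ) ∈ S := Algebra.subset_adjoin (by simp)
  have m2 : (X 1 ^ 3 : MvPolynomial (Fin 3) ℂ) ∈ S := Algebra.subset_adjoin (by simp)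
  have m3 : (X 0 * X 1 : MvPolynomial (Fin 3) ℂ) ∈ S := Algebra.subset_adjoin (by simp)
  have m4 : (X 2 : MvPolynomial (Fin 3) ℂ) ∈ S := Algebra.subset_adjoin (by simp)
  have key : ∀ p : MvPolynomial (Fin 3) ℂ, p + ρ p + ρ (ρ p) ∈ S := by
    intro p
    induction p using MvPolynomial.induction_on' with
    | add p q hp hq =>
      have := S.add_mem hp hq
      simp only [map_add]
      convert this using 1
      ring
    | monomial s c =>
      rw [monomial_eq, Finsupp.prod_fintype _ _ (by simp), Fin.prod_univ_three]
      generalize s 0 = a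
      generalize s 1 = b
      generalize s 2 = d
      have e1 : ρ (C c * (X 0 ^ a * X 1 ^ b * X 2 ^ d)) =
          C (ω ^ (a + 2 * b)) * (C c * (X 0 ^ a * X 1 ^ b * X 2 ^ d)) := by
        simp only [map_mul, map_pow, hX, hY, hz, hC]
        ring
      rw [e1, map_mul, hC, e1]
      set w := ω ^ (a + 2 * b) with hw
      have hw3 : w ^ 3 = 1 := by rw [hw, ← pow_mul, mul_comm, pow_mul, h3, one_pow]
      have e2 : ∀ M : MvPolynomial (Fin 3) ℂ, M + C w * M + C w * (C w * M) =
          C (1 + w + w ^ 2) * M := by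
        intro M
        simp only [C_add, C_pow, C_1]
        ring
      rw [e2]
      by_cases h : w = 1
      · have hd : 3 ∣ a + 2 * b := hω.dvd_of_pow_eq_one _ h
        refine S.mul_mem (S.algebraMap_mem _) (S.mul_mem (S.algebraMap_mem _)
          (S.mul_mem ?_ (S.pow_mem m4 _)))
        rcases le_total a b with hab | hab
        · obtain ⟨k, rfl⟩ : ∃ k, b = a + 3 * k := ⟨(b - a) / 3, by omega⟩
          convert S.mul_mem (S.pow_mem m3 a) (S.pow_mem m2 k) using 1
          ring
        · obtain ⟨k, rfl⟩ : ∃ k, a = b + 3 * k := ⟨(a - b) / 3, by omega⟩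
          convert S.mul_mem (S.pow_mem m3 b) (S.pow_mem m1 k) using 1
          ring
      · have h0 : 1 + w + w ^ 2 = 0 := by
          have : (w - 1) * (1 + w + w ^ 2) = 0 := by linear_combination hw3
          exact (mul_eq_zero.mp this).resolve_left (sub_ne_zero.mpr h)
        rw [h0, C_0, zero_mul]
        exact S.zero_mem
  ext p
  simp only [Set.mem_setOf_eq, SetLike.mem_coe]
  constructor
  · intro hp
    have h := S.smul_mem (key p) (1 / 3 : ℂ)
    rw [hp, hp] at h
    convert h using 1
    module
  · intro hp
    have hle : S ≤ AlgHom.equalizer (ρ : MvPolynomial (Fin 3) ℂ →ₐ[ℂ] MvPolynomial (Fin 3) ℂ)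
        (AlgHom.id ℂ _) := by
      rw [hS, Algebra.adjoin_le_iff]
      rintro x (rfl | rfl | rfl | rfl)
      · simp [AlgHom.mem_equalizer, hX, mul_pow, hC3]
      · change ρ (X 1 ^ 3) = X 1 ^ 3
        rw [map_pow, hY]
        linear_combination (X 1 ^ 3) * (C ω ^ 3 + 1) * hC3
      · change ρ (X 0 * X 1) = X 0 * X 1
        rw [map_mul, hX, hY]
        linear_combination (X 0 * X 1) * hC3
      · simp [AlgHom.mem_equalizer, hz]
    exact hle hp
end
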